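/- arXiv:math-ph/0509054 — 2 statements merged into one kernel-verified Lean document; each statement's English description precedes it below -/
import Mathlib

section
/- If a linear map a : H → A satisfies a(1_H) = 1_A, the cocycle condition a(gh) = a(g₍₁₎)(g₍₂₎ ▷ a(h)), the centrality condition (g₍₁₎ ▷ b)·a(g₍₂₎) = a(g₍₁₎)·(g₍₂₎ ▷ b) for all b ∈ A, and the unitarity condition a(g₍₁₎)·a(S(g₍₂₎*))* = ε(g)·1_A, then a is invertible with respect to the convolution product, and the set U(H, A) of all such maps forms a group under convolution. -/
open TensorProduct

noncomputable section

/-- The data of a Hopf `*`-algebra structure (over `ℂ`) on a `*`-algebra `H`,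
together with a chosen Sweedler representation `rep` of the comultiplication:
`Δ(g) = Σᵢ g₍₁₎ᵢ ⊗ g₍₂₎ᵢ` where the pairs `(g₍₁₎ᵢ, g₍₂₎ᵢ)` are listed by `rep g`. -/
structure HopfStarData (H : Type) [Ring H] [Algebra ℂ H] [StarRing H] : Type where
  comul : H →ₗ[ℂ] H ⊗[ℂ] H
  counit : H →ₗ[ℂ] ℂ
  antipode : H →ₗ[ℂ] H
  rep : H → List (H × H)
  rep_spec : ∀ g, comul g = ((rep g).map fun p => p.1 ⊗ₜ[ℂ] p.2).sum
  comul_one : comul 1 = 1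
  comul_mul : ∀ g h, comul (g * h) = comul g * comul h
  counit_one : counit 1 = 1
  counit_mul : ∀ g h, counit (g * h) = counit g * counit h
  coassoc : (TensorProduct.assoc ℂ H H H).toLinearMap ∘ₗ
      (TensorProduct.map comul LinearMap.id) ∘ₗ comul
      = (TensorProduct.map LinearMap.id comul) ∘ₗ comul
  counit_comul_left : ∀ g, ((rep g).map fun p => counit p.1 • p.2).sum = g
  counit_comul_right : ∀ g, ((rep g).map fun p => counit p.2 • p.1).sum = g
  antipode_left : ∀ g, ((rep g).map fun p => antipode p.1 * p.2).sum = counit g • (1 : H)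
  antipode_right : ∀ g, ((rep g).map fun p => p.1 * antipode p.2).sum = counit g • (1 : H)
  comul_star : ∀ g, comul (star g) = ((rep g).map fun p => star p.1 ⊗ₜ[ℂ] star p.2).sum
  counit_star : ∀ g, counit (star g) = starRingEnd ℂ (counit g)
  antipode_star : ∀ g, antipode (star (antipode (star g))) = g

variable {H A : Type} [Ring H] [Algebra ℂ H] [StarRing H]

/-- `act` is a Hopf-algebraic `*`-action of `(H, D)` on the `*`-algebra `A`:
`g ▷ (xy) = (g₍₁₎ ▷ x)(g₍₂₎ ▷ y)`, `g ▷ 1 = ε(g)1` and `(g ▷ x)* = S(g)* ▷ x*`. -/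
def IsStarAction [Ring A] [Algebra ℂ A] [StarRing A]
    (D : HopfStarData H) (act : H →ₗ[ℂ] A →ₗ[ℂ] A) : Prop :=
  (∀ g h x, act (g * h) x = act g (act h x)) ∧
  (∀ x, act 1 x = x) ∧
  (∀ g x y, act g (x * y) = ((D.rep g).map fun p => act p.1 x * act p.2 y).sum) ∧
  (∀ g, act g 1 = D.counit g • 1) ∧
  (∀ g x, star (act g x) = act (star (D.antipode g)) (star x))

/-- The convolution product on `Hom(H, A)`: `(a * b)(g) = a(g₍₁₎) b(g₍₂₎)`. -/
def conv [Ring A] [Algebra ℂ A] (D : HopfStarData H) (a b : H →ₗ[ℂ] A) : H →ₗ[ℂ] A :=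
  LinearMap.mul' ℂ A ∘ₗ TensorProduct.map a b ∘ₗ D.comul

/-- The convolution unit `e(g) = ε(g) 1`. -/
def convUnit [Ring A] [Algebra ℂ A] (D : HopfStarData H) : H →ₗ[ℂ] A :=
  Algebra.linearMap ℂ A ∘ₗ D.counit

/-- Membership in `U(H, A)`: normalization, the cocycle condition, centrality and
unitarity, cf. (13)–(16) in the paper. -/
def IsUElem [Ring A] [Algebra ℂ A] [StarRing A]
    (D : HopfStarData H) (act : H →ₗ[ℂ] A →ₗ[ℂ] A) (a : H →ₗ[ℂ] A) : Prop :=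
  a 1 = 1 ∧
  (∀ g h, a (g * h) = ((D.rep g).map fun p => a p.1 * act p.2 (a h)).sum) ∧
  (∀ g b, ((D.rep g).map fun p => act p.1 b * a p.2).sum
        = ((D.rep g).map fun p => a p.1 * act p.2 b).sum) ∧
  (∀ g, ((D.rep g).map fun p => a p.1 * star (a (D.antipode (star p.2)))).sum
      = D.counit g • 1)

/-- `c` is a central element of `A`. -/
def IsCentral [Ring A] (c : A) : Prop := ∀ x, c * x = x * c

/-- `c` is a unitary central element of `A`. -/
def IsUnitaryCentral [Ring A] [StarRing A] (c : A) : Prop :=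
  IsCentral c ∧ star c * c = 1 ∧ c * star c = 1

/-- For a unitary central element `c`, the map `ĉ(g) = c · (g ▷ c⁻¹) = c · (g ▷ c*)`. -/
def chat [Ring A] [Algebra ℂ A] [StarRing A]
    (act : H →ₗ[ℂ] A →ₗ[ℂ] A) (c : A) : H →ₗ[ℂ] A :=
  LinearMap.mulLeft ℂ c ∘ₗ act.flip (star c)

section Convolution

open Coalgebra HopfAlgebra WithConv

variable {k K B : Type*} [CommRing k] [Ring K] [HopfAlgebra k K] [Ring B] [Algebra k B]

lemma AlgHom.conv_comp_antipode_left (ψ : K →ₐ[k] B) :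
    toConv (ψ.toLinearMap ∘ₗ antipode k) * toConv ψ.toLinearMap = 1 := by
  have h := LinearMap.algHom_comp_convMul_distrib ψ (toConv (antipode k (A := K)))
    (toConv LinearMap.id)
  rw [LinearMap.antipode_mul_id] at h
  refine WithConv.ext (h.symm.trans ?_)
  ext x
  simp [LinearMap.convOne_def]

lemma AlgHom.conv_comp_antipode_right (ψ : K →ₐ[k] B) :
    toConv ψ.toLinearMap * toConv (ψ.toLinearMap ∘ₗ antipode k) = 1 := by
  have h := LinearMap.algHom_comp_convMul_distrib ψ (toConv LinearMap.id)
    (toConv (antipode k (A := K)))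
  rw [LinearMap.id_mul_antipode] at h
  refine WithConv.ext (h.symm.trans ?_)
  ext x
  simp [LinearMap.convOne_def]

/-- The antipode reverses the comultiplication. -/
lemma HopfAlgebra.comul_antipode (g : K) :
    comul (R := k) (antipode k g) =
      TensorProduct.map (antipode k) (antipode k) (TensorProduct.comm k K K (comul g)) := by
  let i : K →ₐ[k] K ⊗[k] K := Algebra.TensorProduct.includeLeft
  let j : K →ₐ[k] K ⊗[k] K := Algebra.TensorProduct.includeRight
  have hδ : toConv (comul (R := k) (A := K)) = toConv i.toLinearMap * toConv j.toLinearMap := by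
    ext x
    rw [(ℛ k x).convMul_apply]
    simp [i, j, (ℛ k x).eq]
  have hG : toConv (TensorProduct.map (antipode k) (antipode k) ∘ₗ
      (TensorProduct.comm k K K).toLinearMap ∘ₗ comul) =
      toConv (j.toLinearMap ∘ₗ antipode k) * toConv (i.toLinearMap ∘ₗ antipode k) := by
    ext x
    rw [(ℛ k x).convMul_apply]
    simp [i, j, ← (ℛ k x).eq]
  have hinv : toConv (TensorProduct.map (antipode k) (antipode k) ∘ₗ
      (TensorProduct.comm k K K).toLinearMap ∘ₗ comul) * toConv (comul (R := k) (A := K)) = 1 := by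
    rw [hG, hδ, mul_assoc, ← mul_assoc (toConv (i.toLinearMap ∘ₗ _)),
      i.conv_comp_antipode_left, one_mul, j.conv_comp_antipode_left]
  have h := left_inv_eq_right_inv hinv LinearMap.comul_right_inv
  exact (congr($(h).ofConv g)).symm

end Convolution

/-- `act` makes the algebra `B` into a module algebra over the Hopf algebra `K`. -/
structure IsModuleAlgebra {k K B : Type*} [CommRing k] [Ring K] [HopfAlgebra k K] [Ring B]
    [Algebra k B] (act : K →ₗ[k] B →ₗ[k] B) : Prop where
  mul_act : ∀ g h x, act (g * h) x = act g (act h x)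
  one_act : ∀ x, act 1 x = x
  act_mul : ∀ x y, WithConv.toConv (act.flip (x * y)) =
    WithConv.toConv (act.flip x) * WithConv.toConv (act.flip y)
  act_one : WithConv.toConv (act.flip 1) = 1

namespace IsModuleAlgebra

open Coalgebra HopfAlgebra WithConv

variable {k K B : Type*} [CommRing k] [Ring K] [HopfAlgebra k K] [Ring B] [Algebra k B]
  {act : K →ₗ[k] B →ₗ[k] B}

/-- `translate f h g = f (g * h)`, as a convolution-multiplicative map. -/
def translate : WithConv (K →ₗ[k] B) →* WithConv (K →ₗ[k] WithConv (K →ₗ[k] B)) where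
  toFun f := toConv ((WithConv.linearEquiv k (K →ₗ[k] B)).symm.toLinearMap ∘ₗ
    (LinearMap.mul k K).flip.compr₂ f.ofConv)
  map_one' := by
    ext h g
    simp [mul_comm, Algebra.smul_def]
  map_mul' f₁ f₂ := by
    ext h g
    rw [(ℛ k h).convMul_apply]
    simp only [ofConv_sum, LinearMap.sum_apply, (ℛ k g).convMul_apply]
    simp [← ((ℛ k g).mul (ℛ k h)).eq, Finset.sum_product_right]

@[simp] lemma translate_apply (f : WithConv (K →ₗ[k] B)) (h g : K) :
    translate f h g = f (g * h) := rfl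

lemma smulRight_mul_apply {C : Type*} [Ring C] [Algebra k C] (c : C)
    (X : WithConv (K →ₗ[k] C)) (h : K) :
    (toConv ((counit (R := k) (A := K)).smulRight c) * X) h = c * X h := by
  rw [(ℛ k h).convMul_apply]
  conv_rhs => rw [← sum_counit_smul (ℛ k h)]
  simp [Finset.mul_sum]

lemma mul_smulRight_apply {C : Type*} [Ring C] [Algebra k C] (c : C)
    (X : WithConv (K →ₗ[k] C)) (h : K) :
    (X * toConv ((counit (R := k) (A := K)).smulRight c)) h = X h * c := by
  have e : ∑ i ∈ (ℛ k h).index, counit (R := k) ((ℛ k h).right i) • (ℛ k h).left i = h := by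
    simpa only [map_sum, TensorProduct.rid_tmul, one_smul] using
      congr(TensorProduct.rid k K $(sum_tmul_counit_eq (ℛ k h)))
  rw [(ℛ k h).convMul_apply]
  conv_rhs => rw [← e]
  simp [Finset.sum_mul]

/-- `const f h = ε(h) f`, as a convolution-multiplicative map. -/
def const : WithConv (K →ₗ[k] B) →* WithConv (K →ₗ[k] WithConv (K →ₗ[k] B)) where
  toFun f := toConv ((counit (R := k) (A := K)).smulRight f)
  map_one' := by
    ext h g
    simp [Algebra.smul_def]
  map_mul' f₁ f₂ := by
    ext1; ext1 h
    rw [smulRight_mul_apply]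
    simp

lemma const_mul_apply (f : WithConv (K →ₗ[k] B))
    (X : WithConv (K →ₗ[k] WithConv (K →ₗ[k] B))) (h : K) :
    (const f * X) h = f * X h :=
  smulRight_mul_apply f X h

lemma mul_const_apply (f : WithConv (K →ₗ[k] B))
    (X : WithConv (K →ₗ[k] WithConv (K →ₗ[k] B))) (h : K) :
    (X * const f) h = X h * f :=
  mul_smulRight_apply f X h

/-- `orbit f h g = g ▷ f h`, as a convolution-multiplicative map. -/
def orbit (hact : IsModuleAlgebra act) :
    WithConv (K →ₗ[k] B) →* WithConv (K →ₗ[k] WithConv (K →ₗ[k] B)) where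
  toFun f := toConv ((WithConv.linearEquiv k (K →ₗ[k] B)).symm.toLinearMap ∘ₗ
    act.flip ∘ₗ f.ofConv)
  map_one' := by
    ext1; ext1 h
    have := hact.act_one
    simp [Algebra.algebraMap_eq_smul_one, this]
  map_mul' f₁ f₂ := by
    ext1; ext1 h
    rw [(ℛ k h).convMul_apply]
    simp only [LinearMap.comp_apply, (ℛ k h).convMul_apply, map_sum]
    exact Finset.sum_congr rfl fun i _ => hact.act_mul _ _

@[simp] lemma orbit_apply (hact : IsModuleAlgebra act) (f : WithConv (K →ₗ[k] B)) (h : K) :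
    hact.orbit f h = toConv (act.flip (f h)) := rfl

variable (hact : IsModuleAlgebra act) {a b : WithConv (K →ₗ[k] B)}

lemma const_orbit_comm (ha : ∀ x, Commute (toConv (act.flip x)) a)
    (f : WithConv (K →ₗ[k] B)) : Commute (const a) (hact.orbit f) := by
  ext1; ext1 h
  rw [const_mul_apply, mul_const_apply, orbit_apply]
  exact (ha _).symm

/-- The cocycle identity `a(gh) = a(g₍₁₎) (g₍₂₎ ▷ a(h))`. -/
lemma translate_eq_iff : translate a = const a * hact.orbit a ↔
    ∀ g h, a (g * h) = (a * toConv (act.flip (a h))) g := by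
  constructor
  · intro H g h
    rw [← translate_apply, H, const_mul_apply, orbit_apply]
  · intro H
    ext h g
    rw [translate_apply, const_mul_apply, orbit_apply, H]

lemma translate_mul (hb : ∀ x, Commute (toConv (act.flip x)) b)
    (ha' : translate a = const a * hact.orbit a) (hb' : translate b = const b * hact.orbit b) :
    translate (a * b) = const (a * b) * hact.orbit (a * b) := by
  simp only [map_mul]
  rw [ha', hb', (hact.const_orbit_comm hb a).symm.mul_mul_mul_comm]

lemma translate_inv (hb : ∀ x, Commute (toConv (act.flip x)) b) (hab : a * b = 1) (hba : b * a = 1)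
    (ha : translate a = const a * hact.orbit a) :
    translate b = const b * hact.orbit b := by
  refine left_inv_eq_right_inv (a := translate a) (by rw [← map_mul, hba, map_one]) ?_
  rw [ha, (hact.const_orbit_comm hb a).symm.mul_mul_mul_comm, ← map_mul, ← map_mul, hab]
  simp

/-- The algebra homomorphism `g ↦ (x ↦ a(g₍₁₎) (g₍₂₎ ▷ x))` attached to a cocycle `a`. -/
def twist (h1 : a 1 = 1) (ha : translate a = const a * hact.orbit a) :
    K →ₐ[k] Module.End k B :=
  .ofLinearMap (toConv (LinearMap.mul k B ∘ₗ a.ofConv) * toConv act :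
      WithConv (K →ₗ[k] Module.End k B)).ofConv
    (by ext x; simp [h1, hact.one_act, Algebra.TensorProduct.one_def])
    (by
      have key : ∀ g x, (toConv (LinearMap.mul k B ∘ₗ a.ofConv) * toConv act :
          WithConv (K →ₗ[k] Module.End k B)) g x = (a * toConv (act.flip x)) g := by
        intro g x
        rw [(ℛ k g).convMul_apply, (ℛ k g).convMul_apply]
        simp
      intro g h
      ext x
      rw [Module.End.mul_apply, key, key, key]
      have H : translate (toConv (act.flip x)) = hact.orbit (toConv (act.flip x)) := by
        ext h g
        simp [hact.mul_act]
      rw [← translate_apply, map_mul, ha, H, mul_assoc, ← map_mul, const_mul_apply, orbit_apply])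

lemma mul_eq_one_comm_of_cocycle (h1 : a 1 = 1) (ha : translate a = const a * hact.orbit a)
    (hab : a * b = 1) : b * a = 1 := by
  let lam : B →ₐ[k] Module.End k B := Algebra.lmul k B
  let L : K →ₐ[k] Module.End k B := .ofLinearMap act (by ext x; simp [hact.one_act])
    (by intro g h; ext x; simp [hact.mul_act])
  let M : WithConv (K →ₗ[k] B) → WithConv (K →ₗ[k] Module.End k B) :=
    fun f => toConv (lam.toLinearMap ∘ₗ f.ofConv)
  have hM : ∀ f g, M (f * g) = M f * M g := fun f g =>
    WithConv.ext (LinearMap.algHom_comp_convMul_distrib lam f g)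
  have hφ : toConv (hact.twist h1 ha).toLinearMap = M a * toConv L.toLinearMap := rfl
  have hM1 : M 1 = 1 := by ext; simp [M, lam, Algebra.smul_def]
  have hl : toConv L.toLinearMap * toConv ((hact.twist h1 ha).toLinearMap ∘ₗ antipode k) * M a
      = 1 := by
    have e : M a = toConv (hact.twist h1 ha).toLinearMap *
        toConv (L.toLinearMap ∘ₗ antipode k) := by
      rw [hφ, mul_assoc, L.conv_comp_antipode_right, mul_one]
    rw [e, mul_assoc, ← mul_assoc (toConv (_ ∘ₗ _)), AlgHom.conv_comp_antipode_left, one_mul,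
      L.conv_comp_antipode_right]
  have hr : M a * M b = 1 := by rw [← hM, hab, hM1]
  have hba : M (b * a) = M 1 := by
    rw [hM, hM1, ← left_inv_eq_right_inv hl hr, hl]
  ext g
  simpa [M, lam] using congr($(hba).ofConv g 1)

end IsModuleAlgebra

namespace HopfStarData

variable (D : HopfStarData H)

lemma map_comul {M : Type*} [AddCommMonoid M] [Module ℂ M] (f : H ⊗[ℂ] H →ₗ[ℂ] M) (g : H) :
    f (D.comul g) = ((D.rep g).map fun p => f (p.1 ⊗ₜ p.2)).sum := by
  rw [D.rep_spec, map_list_sum, List.map_map]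
  rfl

/-- The coalgebra underlying a Hopf `*`-algebra. -/
@[reducible] def coalgebra : Coalgebra ℂ H where
  comul := D.comul
  counit := D.counit
  coassoc := D.coassoc
  rTensor_counit_comp_comul := by
    ext g
    apply (TensorProduct.lid ℂ H).injective
    refine (D.map_comul ((TensorProduct.lid ℂ H).toLinearMap ∘ₗ D.counit.rTensor H) g).trans ?_
    simpa using D.counit_comul_left g
  lTensor_counit_comp_comul := by
    ext g
    apply (TensorProduct.rid ℂ H).injective
    refine (D.map_comul ((TensorProduct.rid ℂ H).toLinearMap ∘ₗ D.counit.lTensor H) g).trans ?_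
    simpa using D.counit_comul_right g

/-- The bialgebra underlying a Hopf `*`-algebra. -/
@[reducible] def bialgebra : Bialgebra ℂ H :=
  letI := D.coalgebra
  Bialgebra.mk' ℂ H D.counit_one (D.counit_mul _ _) D.comul_one (D.comul_mul _ _)

/-- The Hopf algebra underlying a Hopf `*`-algebra. -/
@[reducible] def hopfAlgebra : HopfAlgebra ℂ H where
  toBialgebra := D.bialgebra
  antipode := D.antipode
  mul_antipode_rTensor_comul := by
    ext g
    refine (D.map_comul (LinearMap.mul' ℂ H ∘ₗ D.antipode.rTensor H) g).trans
      (Eq.trans ?_ (Algebra.algebraMap_eq_smul_one (D.counit g)).symm)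
    simpa only [LinearMap.comp_apply, LinearMap.rTensor_tmul, LinearMap.mul'_apply] using
      D.antipode_left g
  mul_antipode_lTensor_comul := by
    ext g
    refine (D.map_comul (LinearMap.mul' ℂ H ∘ₗ D.antipode.lTensor H) g).trans
      (Eq.trans ?_ (Algebra.algebraMap_eq_smul_one (D.counit g)).symm)
    simpa only [LinearMap.comp_apply, LinearMap.lTensor_tmul, LinearMap.mul'_apply] using
      D.antipode_right g

lemma antipode_one : D.antipode 1 = 1 :=
  letI := D.hopfAlgebra
  HopfAlgebra.antipode_one (R := ℂ) (A := H)

lemma counit_antipode (g : H) : D.counit (D.antipode g) = D.counit g :=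
  letI := D.hopfAlgebra
  HopfAlgebra.counit_antipode (R := ℂ) g

lemma star_antipode_star_antipode (g : H) : star (D.antipode (star (D.antipode g))) = g := by
  have h := D.antipode_star (star g)
  rw [star_star] at h
  rw [h, star_star]

/-- The inverse `g ↦ S(g*)*` of the antipode. -/
def antipodeInv : H →ₗ[ℂ] H where
  toFun g := star (D.antipode (star g))
  map_add' x y := by simp
  map_smul' c x := by
    have h : c • x = D.antipode (c • star (D.antipode (star x))) := by
      rw [map_smul, D.antipode_star]
    rw [h, star_antipode_star_antipode, RingHom.id_apply]

lemma antipodeInv_apply (g : H) : D.antipodeInv g = star (D.antipode (star g)) := rfl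

lemma starModule (D : HopfStarData H) : StarModule ℂ H := by
  have key : ∀ c : ℂ, star (c • (1 : H)) = star c • (1 : H) := by
    intro c
    have h₁ : ((D.rep (c • 1)).map fun p => star p.1 * D.antipode (star p.2)).sum
        = star c • (1 : H) := by
      have h := D.map_comul (LinearMap.mul' ℂ H ∘ₗ D.antipode.lTensor H) (star (c • 1))
      simp only [LinearMap.comp_apply, LinearMap.lTensor_tmul, LinearMap.mul'_apply,
        D.antipode_right, D.counit_star, map_smul, D.counit_one] at h
      rw [D.comul_star, map_list_sum, map_list_sum, List.map_map, List.map_map] at h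
      simpa [Function.comp_def] using h
    have h₂ : ((D.rep (c • 1)).map fun p => D.antipodeInv p.2 * p.1).sum = c • (1 : H) := by
      have h := D.map_comul (LinearMap.mul' ℂ H ∘ₗ D.antipodeInv.rTensor H ∘ₗ
        (TensorProduct.comm ℂ H H).toLinearMap) (c • 1)
      simp only [map_smul, D.comul_one, Algebra.TensorProduct.one_def] at h
      simpa [antipodeInv_apply, D.antipode_one] using h.symm
    rw [← h₁, ← starAddEquiv_apply, ← congrArg starAddEquiv h₂, map_list_sum, List.map_map]
    simp [Function.comp_def, antipodeInv_apply]
  refine ⟨fun c x => ?_⟩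
  rw [← one_mul x, ← smul_mul_assoc, star_mul, key, mul_smul_comm, star_mul, star_one]

end HopfStarData

namespace IsStarAction

variable [Ring A] [Algebra ℂ A] [StarRing A] {D : HopfStarData H} {act : H →ₗ[ℂ] A →ₗ[ℂ] A}

lemma starModule (hact : IsStarAction D act) : StarModule ℂ A := by
  obtain ⟨-, h1, -, -, hstar⟩ := hact
  have := D.starModule
  refine ⟨fun c x => ?_⟩
  have h := hstar (c • 1) x
  have e : star (c • (1 : H)) = star c • (1 : H) := by rw [star_smul, star_one]
  rwa [map_smul, LinearMap.smul_apply, h1, map_smul, D.antipode_one, e, map_smul,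
    LinearMap.smul_apply, h1] at h

lemma isModuleAlgebra (hact : IsStarAction D act) :
    letI := D.hopfAlgebra
    IsModuleAlgebra act := by
  let := D.hopfAlgebra
  obtain ⟨hm, h1, hmul, hone, -⟩ := hact
  refine ⟨hm, h1, fun x y => ?_, ?_⟩
  · ext g
    refine (hmul g x y).trans (D.map_comul (LinearMap.mul' ℂ A ∘ₗ
      TensorProduct.map (act.flip x) (act.flip y)) g).symm
  · ext g
    exact (hone g).trans (Algebra.algebraMap_eq_smul_one _).symm

end IsStarAction

section UElem

open WithConv

variable [Ring A] [Algebra ℂ A]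

lemma conv_apply (D : HopfStarData H) (a b : H →ₗ[ℂ] A) (g : H) :
    conv D a b g = ((D.rep g).map fun p => a p.1 * b p.2).sum :=
  D.map_comul (LinearMap.mul' ℂ A ∘ₗ TensorProduct.map a b) g

lemma toConv_conv (D : HopfStarData H) (a b : H →ₗ[ℂ] A) :
    letI := D.hopfAlgebra
    toConv (conv D a b) = toConv a * toConv b := rfl

lemma toConv_convUnit (D : HopfStarData H) :
    letI := D.hopfAlgebra
    toConv (convUnit D : H →ₗ[ℂ] A) = 1 := rfl

variable [StarRing A] {D : HopfStarData H} {act : H →ₗ[ℂ] A →ₗ[ℂ] A}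

/-- The adjoint `a†(g) = a(S(g*))*`. -/
def convAdjoint (D : HopfStarData H) [StarModule ℂ H] [StarModule ℂ A] (a : H →ₗ[ℂ] A) :
    H →ₗ[ℂ] A where
  toFun g := star (a (D.antipode (star g)))
  map_add' x y := by simp
  map_smul' c x := by simp

variable [StarModule ℂ H] [StarModule ℂ A]

lemma convAdjoint_apply (a : H →ₗ[ℂ] A) (g : H) :
    convAdjoint D a g = star (a (D.antipode (star g))) := rfl

lemma convAdjoint_convAdjoint (a : H →ₗ[ℂ] A) : convAdjoint D (convAdjoint D a) = a := by
  ext g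
  simp [convAdjoint_apply, D.antipode_star]

lemma convAdjoint_convUnit : convAdjoint D (convUnit D : H →ₗ[ℂ] A) = convUnit D := by
  ext g
  simp [convAdjoint_apply, convUnit, D.counit_antipode, D.counit_star,
    Algebra.algebraMap_eq_smul_one]

lemma convAdjoint_conv (a b : H →ₗ[ℂ] A) :
    convAdjoint D (conv D a b) = conv D (convAdjoint D b) (convAdjoint D a) := by
  let := D.hopfAlgebra
  ext g
  have h : D.comul (D.antipode (star g)) = _ := HopfAlgebra.comul_antipode (k := ℂ) (star g)
  change _ = TensorProduct.map D.antipode D.antipode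
    (TensorProduct.comm ℂ H H (D.comul (star g))) at h
  rw [conv_apply, convAdjoint_apply, conv, LinearMap.comp_apply, LinearMap.comp_apply, h,
    D.comul_star]
  simp only [map_list_sum, List.map_map]
  rw [← starAddEquiv_apply, map_list_sum, List.map_map]
  simp [Function.comp_def, convAdjoint_apply]

lemma isUElem_iff (hact : IsStarAction D act) (a : H →ₗ[ℂ] A) :
    letI := D.hopfAlgebra
    IsUElem D act a ↔ a 1 = 1 ∧
      IsModuleAlgebra.translate (toConv a) =
        IsModuleAlgebra.const (toConv a) * hact.isModuleAlgebra.orbit (toConv a) ∧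
      (∀ x, Commute (toConv (act.flip x)) (toConv a)) ∧
      toConv a * toConv (convAdjoint D a) = 1 := by
  let := D.hopfAlgebra
  refine and_congr Iff.rfl (and_congr ?_ (and_congr ?_ ?_))
  · rw [hact.isModuleAlgebra.translate_eq_iff]
    refine forall₂_congr fun g h => ?_
    rw [← toConv_conv, ofConv_toConv, conv_apply]
    rfl
  · rw [forall_comm]
    refine forall_congr' fun x => ?_
    rw [commute_iff_eq, ← toConv_conv, ← toConv_conv, toConv_injective.eq_iff, LinearMap.ext_iff]
    simp only [conv_apply, LinearMap.flip_apply]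
  · rw [← toConv_conv, ← toConv_convUnit D, toConv_injective.eq_iff, LinearMap.ext_iff]
    simp only [conv_apply, convAdjoint_apply, convUnit, LinearMap.comp_apply,
      Algebra.linearMap_apply, Algebra.algebraMap_eq_smul_one]

end UElem

/-- every element of `U(H, A)` is convolution invertible (with inverse
again in `U(H, A)`), and `U(H, A)` is a group under convolution: it contains the
convolution unit, is closed under convolution, and contains inverses. -/
theorem U_is_group_under_convolution
    [Ring A] [Algebra ℂ A] [StarRing A]
    (D : HopfStarData H) (act : H →ₗ[ℂ] A →ₗ[ℂ] A)
    (hact : IsStarAction D act) :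
    IsUElem D act (convUnit D) ∧
    (∀ a b, IsUElem D act a → IsUElem D act b → IsUElem D act (conv D a b)) ∧
    (∀ a, IsUElem D act a →
      ∃ b, IsUElem D act b ∧ conv D a b = convUnit D ∧ conv D b a = convUnit D) := by
  let := D.hopfAlgebra
  have := D.starModule
  have := hact.starModule
  have hM := hact.isModuleAlgebra
  simp only [isUElem_iff hact]
  refine ⟨⟨?_, ?_, ?_, ?_⟩, ?_, ?_⟩
  · simp [convUnit, D.counit_one]
  · simp [toConv_convUnit]
  · exact fun x => Commute.one_right _
  · rw [convAdjoint_convUnit, toConv_convUnit, one_mul]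
  · rintro a b ⟨ha1, ha, hac, hau⟩ ⟨hb1, hb, hbc, hbu⟩
    refine ⟨?_, ?_, ?_, ?_⟩
    · simp [conv, D.comul_one, Algebra.TensorProduct.one_def, ha1, hb1]
    · rw [toConv_conv]
      exact hM.translate_mul hbc ha hb
    · intro x
      rw [toConv_conv]
      exact (hac x).mul_right (hbc x)
    · rw [convAdjoint_conv, toConv_conv, toConv_conv, mul_assoc, ← mul_assoc (WithConv.toConv b), hbu,
        one_mul, hau]
  · rintro a ⟨ha1, ha, hac, hau⟩
    have hua := hM.mul_eq_one_comm_of_cocycle ha1 ha hau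
    have hbc : ∀ x, Commute (WithConv.toConv (act.flip x)) (WithConv.toConv (convAdjoint D a)) := fun x =>
      (hac x).units_inv_right (u := ⟨WithConv.toConv a, WithConv.toConv (convAdjoint D a), hau, hua⟩)
    refine ⟨convAdjoint D a, ⟨?_, hM.translate_inv hbc hau hua ha, hbc, ?_⟩,
      WithConv.toConv_injective hau, WithConv.toConv_injective hua⟩
    · rw [convAdjoint_apply, star_one, D.antipode_one, ha1, star_one]
    · rw [convAdjoint_convAdjoint, hua]
end
end

section
/- If H is cocommutative, then for any a ∈ U(H, A), all values a(g) for g ∈ H lie in the center Z(A) of A; consequently U(H, A) = U(H, Z(A)) and U(H, A) is an abelian group. -/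
open TensorProduct

noncomputable section

variable {H A : Type} [Ring H] [Algebra ℂ H] [StarRing H]

namespace HopfStarData

/-- Summing a linear functional of `g₍₁₎ ⊗ g₍₂₎` over the chosen Sweedler representation evaluates
it at the comultiplication. -/
theorem sum_rep {M : Type*} [AddCommMonoid M] [Module ℂ M] (D : HopfStarData H)
    (f : H ⊗[ℂ] H →ₗ[ℂ] M) (g : H) :
    ((D.rep g).map fun p => f (p.1 ⊗ₜ[ℂ] p.2)).sum = f (D.comul g) := by
  rw [D.rep_spec g, map_list_sum, List.map_map]
  rfl

/-- Coassociativity in Sweedler notation. -/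
theorem sum_rep_coassoc {M : Type*} [AddCommMonoid M] [Module ℂ M] (D : HopfStarData H)
    (f : H ⊗[ℂ] (H ⊗[ℂ] H) →ₗ[ℂ] M) (g : H) :
    ((D.rep g).map fun p =>
        ((D.rep p.1).map fun q => f (q.1 ⊗ₜ[ℂ] (q.2 ⊗ₜ[ℂ] p.2))).sum).sum =
      ((D.rep g).map fun p =>
        ((D.rep p.2).map fun q => f (p.1 ⊗ₜ[ℂ] (q.1 ⊗ₜ[ℂ] q.2))).sum).sum := by
  have hl : ∀ p : H × H,
      ((D.rep p.1).map fun q => f (q.1 ⊗ₜ[ℂ] (q.2 ⊗ₜ[ℂ] p.2))).sum =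
        (f ∘ₗ (TensorProduct.assoc ℂ H H H).toLinearMap ∘ₗ
          TensorProduct.map D.comul LinearMap.id) (p.1 ⊗ₜ[ℂ] p.2) := fun p =>
    D.sum_rep (f ∘ₗ (TensorProduct.assoc ℂ H H H).toLinearMap ∘ₗ
      (TensorProduct.mk ℂ (H ⊗[ℂ] H) H).flip p.2) p.1
  have hr : ∀ p : H × H,
      ((D.rep p.2).map fun q => f (p.1 ⊗ₜ[ℂ] (q.1 ⊗ₜ[ℂ] q.2))).sum =
        (f ∘ₗ TensorProduct.map LinearMap.id D.comul) (p.1 ⊗ₜ[ℂ] p.2) := fun p =>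
    D.sum_rep (f ∘ₗ TensorProduct.mk ℂ H (H ⊗[ℂ] H) p.1) p.2
  simp only [hl, hr, D.sum_rep]
  exact congrArg f (LinearMap.congr_fun D.coassoc g)

/-- Cocommutativity in Sweedler notation. -/
theorem sum_rep_swap {M : Type*} [AddCommMonoid M] [Module ℂ M] (D : HopfStarData H)
    (hcocomm : ∀ g, (TensorProduct.comm ℂ H H) (D.comul g) = D.comul g)
    (f : H ⊗[ℂ] H →ₗ[ℂ] M) (g : H) :
    ((D.rep g).map fun p => f (p.2 ⊗ₜ[ℂ] p.1)).sum =
      ((D.rep g).map fun p => f (p.1 ⊗ₜ[ℂ] p.2)).sum := by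
  refine (D.sum_rep (f ∘ₗ (TensorProduct.comm ℂ H H).toLinearMap) g).trans ?_
  rw [D.sum_rep f g]
  exact congrArg f (hcocomm g)

end HopfStarData

section Action

variable [Ring A] [Algebra ℂ A]

/-- `g₍₁₎ ▷ (S(g₍₂₎) ▷ x) = ε(g) x`. -/
theorem sum_act_act_antipode (D : HopfStarData H) (act : H →ₗ[ℂ] A →ₗ[ℂ] A)
    (hmul : ∀ g h x, act (g * h) x = act g (act h x)) (hone : ∀ x, act 1 x = x) (g : H) (x : A) :
    ((D.rep g).map fun p => act p.1 (act (D.antipode p.2) x)).sum = D.counit g • x := by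
  have h := congrArg (act.flip x) (D.antipode_right g)
  rw [map_list_sum, List.map_map, map_smul, LinearMap.flip_apply, hone] at h
  simpa only [Function.comp_def, LinearMap.flip_apply, hmul] using h

/-- For cocommutative `H`, a map that satisfies the centrality condition takes central values. -/
theorem isCentral_of_cocommutative (D : HopfStarData H) (act : H →ₗ[ℂ] A →ₗ[ℂ] A)
    (hmul : ∀ g h x, act (g * h) x = act g (act h x)) (hone : ∀ x, act 1 x = x)
    (hcocomm : ∀ g, (TensorProduct.comm ℂ H H) (D.comul g) = D.comul g) (a : H →ₗ[ℂ] A)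
    (hcentral : ∀ g b, ((D.rep g).map fun p => act p.1 b * a p.2).sum
        = ((D.rep g).map fun p => a p.1 * act p.2 b).sum) (g : H) :
    IsCentral (a g) := by
  intro x
  let y : H →ₗ[ℂ] A := act.flip x ∘ₗ D.antipode
  let actY : H ⊗[ℂ] H →ₗ[ℂ] A := TensorProduct.lift act ∘ₗ TensorProduct.map LinearMap.id y
  let inner : (H ⊗[ℂ] H) ⊗[ℂ] H →ₗ[ℂ] A := LinearMap.mul' ℂ A ∘ₗ TensorProduct.map actY a
  let left : H ⊗[ℂ] (H ⊗[ℂ] H) →ₗ[ℂ] A := LinearMap.mul' ℂ A ∘ₗ TensorProduct.map a actY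
  let right : H ⊗[ℂ] (H ⊗[ℂ] H) →ₗ[ℂ] A :=
    inner ∘ₗ (TensorProduct.assoc ℂ H H H).symm.toLinearMap
  let swapped : H ⊗[ℂ] (H ⊗[ℂ] H) →ₗ[ℂ] A :=
    right ∘ₗ TensorProduct.map LinearMap.id (TensorProduct.comm ℂ H H).toLinearMap
  have hy : ∀ h, ((D.rep h).map fun p => act p.1 (y p.2)).sum = D.counit h • x := fun h =>
    sum_act_act_antipode D act hmul hone h x
  calc a g * x
      = ((D.rep g).map fun p => a p.1 * (D.counit p.2 • x)).sum := by
        conv_lhs => rw [← D.counit_comul_right g]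
        simp only [map_list_sum, List.map_map, ← List.sum_map_mul_right, Function.comp_def,
          map_smul, smul_mul_assoc, mul_smul_comm]
    _ = ((D.rep g).map fun p =>
          ((D.rep p.2).map fun q => a p.1 * act q.1 (y q.2)).sum).sum := by
        simp only [← hy, ← List.sum_map_mul_left]
    _ = ((D.rep g).map fun p =>
          ((D.rep p.1).map fun q => a q.1 * act q.2 (y p.2)).sum).sum :=
        (D.sum_rep_coassoc left g).symm
    _ = ((D.rep g).map fun p =>
          ((D.rep p.1).map fun q => act q.1 (y p.2) * a q.2).sum).sum := by
        simp only [hcentral]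
    _ = ((D.rep g).map fun p =>
          ((D.rep p.2).map fun q => act p.1 (y q.2) * a q.1).sum).sum :=
        D.sum_rep_coassoc swapped g
    _ = ((D.rep g).map fun p =>
          ((D.rep p.2).map fun q => act p.1 (y q.1) * a q.2).sum).sum := by
        refine congrArg List.sum (List.map_congr_left fun p _ => ?_)
        exact D.sum_rep_swap hcocomm (right ∘ₗ TensorProduct.mk ℂ H (H ⊗[ℂ] H) p.1) p.2
    _ = ((D.rep g).map fun p =>
          ((D.rep p.1).map fun q => act q.1 (y q.2) * a p.2).sum).sum :=
        (D.sum_rep_coassoc right g).symm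
    _ = ((D.rep g).map fun p => (D.counit p.1 • x) * a p.2).sum := by
        simp only [← hy, ← List.sum_map_mul_right]
    _ = x * a g := by
        conv_rhs => rw [← D.counit_comul_left g]
        simp only [map_list_sum, List.map_map, ← List.sum_map_mul_left, Function.comp_def,
          map_smul, smul_mul_assoc, mul_smul_comm]

/-- For cocommutative `H`, a map with central values commutes with every map under convolution. -/
theorem conv_comm_of_isCentral (D : HopfStarData H)
    (hcocomm : ∀ g, (TensorProduct.comm ℂ H H) (D.comul g) = D.comul g) (a b : H →ₗ[ℂ] A)
    (ha : ∀ g, IsCentral (a g)) : conv D a b = conv D b a := by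
  ext g
  calc conv D a b g
      = ((D.rep g).map fun p => a p.1 * b p.2).sum :=
        (D.sum_rep (LinearMap.mul' ℂ A ∘ₗ TensorProduct.map a b) g).symm
    _ = ((D.rep g).map fun p => b p.2 * a p.1).sum :=
        congrArg List.sum (List.map_congr_left fun p _ => ha p.1 (b p.2))
    _ = ((D.rep g).map fun p => b p.1 * a p.2).sum :=
        D.sum_rep_swap hcocomm (LinearMap.mul' ℂ A ∘ₗ TensorProduct.map b a) g
    _ = conv D b a g := D.sum_rep (LinearMap.mul' ℂ A ∘ₗ TensorProduct.map b a) g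

end Action

/-- if `H` is cocommutative then the values of any `a ∈ U(H, A)`
are central in `A` (so `U(H, A) = U(H, Z(A))`), and `U(H, A)` is abelian. -/
theorem cocommutative_U_central_abelian
    [Ring A] [Algebra ℂ A] [StarRing A]
    (D : HopfStarData H) (act : H →ₗ[ℂ] A →ₗ[ℂ] A)
    (hact : IsStarAction D act)
    (hcocomm : ∀ g, (TensorProduct.comm ℂ H H) (D.comul g) = D.comul g) :
    (∀ a, IsUElem D act a → ∀ g, IsCentral (a g)) ∧
    (∀ a b, IsUElem D act a → IsUElem D act b → conv D a b = conv D b a) := by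
  have central : ∀ a, IsUElem D act a → ∀ g, IsCentral (a g) := fun a ha =>
    isCentral_of_cocommutative D act hact.1 hact.2.1 hcocomm a ha.2.2.1
  exact ⟨central, fun a b ha _ => conv_comm_of_isCentral D hcocomm a b (central a ha)⟩
end
end
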